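/- (Proposition 4, inversion in the circular case.) Let φ ∈ ℂ with sin(2φ) ≠ 0, put z₁ = e^{iφ}, z₂ = −e^{−iφ}, z₃ = −e^{iφ}, z₄ = e^{−iφ}, and let q₁, q₂, q₃, q₄ ∈ ℂ and λ ∈ ℂ. If a twice differentiable function F satisfies the symmetric Heun equation with data (z₁,…,z₄; q₁,…,q₄; λ) at a point w ∉ {0, z₁, z₂, z₃, z₄}, then the function G(z) = F(1/z) satisfies the symmetric Heun equation with data (1/z₁, 1/z₂, 1/z₃, 1/z₄; −q₁/z₁², −q₂/z₂², −q₃/z₃², −q₄/z₄²; λ − Σ_{j=1}^4 q_j/z_j) at the point 1/w. -/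

import Mathlib

open Complex

/-- `F` satisfies the symmetric Heun equation with data
`(z₁,…,z₄; q₁,…,q₄; λ)` at the point `z`. -/
def SatisfiesHeun (z₁ z₂ z₃ z₄ q₁ q₂ q₃ q₄ lam : ℂ) (F : ℂ → ℂ) (z : ℂ) : Prop :=
  deriv (deriv F) z
    + (1 / 2) * (1 / (z - z₁) + 1 / (z - z₂) + 1 / (z - z₃) + 1 / (z - z₄)) * deriv F z
    + (1 / ((z - z₁) * (z - z₂) * (z - z₃) * (z - z₄)))
      * (lam + q₁ / (z - z₁) + q₂ / (z - z₂) + q₃ / (z - z₃) + q₄ / (z - z₄)) * F z = 0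

/-- The first derivative of `z ↦ F (1 / z)`. -/
theorem hasDerivAt_comp_one_div {F : ℂ → ℂ} {v : ℂ} (hv : v ≠ 0)
    (hF : DifferentiableAt ℂ F (1 / v)) :
    HasDerivAt (fun z => F (1 / z)) (-(deriv F (1 / v) / v ^ 2)) v := by
  simp only [one_div] at hF ⊢
  exact (hF.hasDerivAt.comp v (hasDerivAt_inv hv)).congr_deriv (by ring)

/-- The second derivative of `z ↦ F (1 / z)` at `1 / w`. -/
theorem deriv_deriv_comp_one_div {F : ℂ → ℂ} {w : ℂ} (hw : w ≠ 0)
    (hF : ∀ᶠ z in nhds w, DifferentiableAt ℂ F z) (hF' : DifferentiableAt ℂ (deriv F) w) :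
    deriv (deriv fun z => F (1 / z)) (1 / w)
      = w ^ 4 * deriv (deriv F) w + 2 * w ^ 3 * deriv F w := by
  have hu : 1 / w ≠ 0 := one_div_ne_zero hw
  have hww : 1 / (1 / w) = w := one_div_one_div w
  have hcont : Filter.Tendsto (fun v : ℂ => 1 / v) (nhds (1 / w)) (nhds w) := by
    simpa only [one_div, inv_inv] using (continuousAt_inv₀ (inv_ne_zero hw)).tendsto
  have hev : deriv (fun z => F (1 / z)) =ᶠ[nhds (1 / w)]
      fun v => -(deriv F (1 / v) / v ^ 2) := by
    filter_upwards [hcont.eventually hF, eventually_ne_nhds hu] with v hFv hv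
    exact (hasDerivAt_comp_one_div hv hFv).deriv
  have hd := hasDerivAt_comp_one_div (F := deriv F) hu (by rwa [hww])
  have hd₂ : HasDerivAt (fun v => -(deriv F (1 / v) / v ^ 2)) _ (1 / w) :=
    (hd.div (hasDerivAt_pow 2 (1 / w)) (pow_ne_zero 2 hu)).neg
  rw [hev.deriv_eq, hd₂.deriv, hww]
  norm_num only [Nat.cast_ofNat, pow_one]
  field_simp
  ring

theorem one_div_one_div_sub_one_div {w z : ℂ} (hw : w ≠ 0) (hz : z ≠ 0) (hwz : w ≠ z) :
    1 / (1 / w - 1 / z) = w - w ^ 2 / (w - z) := by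
  have h₁ : w - z ≠ 0 := sub_ne_zero.mpr hwz
  have h₂ : z - w ≠ 0 := sub_ne_zero.mpr hwz.symm
  rw [div_sub_div _ _ hw hz, one_mul, mul_one]
  field_simp
  ring

theorem neg_div_sq_div_one_div_sub_one_div {w z : ℂ} (q : ℂ) (hw : w ≠ 0) (hz : z ≠ 0)
    (hwz : w ≠ z) : -q / z ^ 2 / (1 / w - 1 / z) = q / z + q / (w - z) := by
  have h₁ : w - z ≠ 0 := sub_ne_zero.mpr hwz
  rw [div_eq_mul_one_div, one_div_one_div_sub_one_div hw hz hwz]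
  field_simp
  ring

/-- The symmetric Heun equation is invariant under inversion when the singular points have
product `1`. -/
theorem SatisfiesHeun.comp_one_div {z₁ z₂ z₃ z₄ q₁ q₂ q₃ q₄ lam w : ℂ} {F : ℂ → ℂ}
    (hprod : z₁ * z₂ * z₃ * z₄ = 1) (hw : w ≠ 0)
    (hw₁ : w ≠ z₁) (hw₂ : w ≠ z₂) (hw₃ : w ≠ z₃) (hw₄ : w ≠ z₄)
    (hF : ∀ᶠ z in nhds w, DifferentiableAt ℂ F z) (hF' : DifferentiableAt ℂ (deriv F) w)
    (heq : SatisfiesHeun z₁ z₂ z₃ z₄ q₁ q₂ q₃ q₄ lam F w) :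
    SatisfiesHeun (1 / z₁) (1 / z₂) (1 / z₃) (1 / z₄)
      (-q₁ / z₁ ^ 2) (-q₂ / z₂ ^ 2) (-q₃ / z₃ ^ 2) (-q₄ / z₄ ^ 2)
      (lam - (q₁ / z₁ + q₂ / z₂ + q₃ / z₃ + q₄ / z₄))
      (fun z => F (1 / z)) (1 / w) := by
  have hne : ((z₁ ≠ 0 ∧ z₂ ≠ 0) ∧ z₃ ≠ 0) ∧ z₄ ≠ 0 := by
    simpa only [mul_ne_zero_iff] using hprod.trans_ne one_ne_zero
  obtain ⟨⟨⟨h₁, h₂⟩, h₃⟩, h₄⟩ := hne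
  have hww : 1 / (1 / w) = w := one_div_one_div w
  have hG : deriv (fun z => F (1 / z)) (1 / w) = -(w ^ 2 * deriv F w) := by
    rw [(hasDerivAt_comp_one_div (one_div_ne_zero hw) (by rw [hww]; exact hF.self_of_nhds)).deriv,
      hww]
    field_simp
  have hP : (1 / w - 1 / z₁) * (1 / w - 1 / z₂) * (1 / w - 1 / z₃) * (1 / w - 1 / z₄)
      = (w - z₁) * (w - z₂) * (w - z₃) * (w - z₄) / w ^ 4 := by
    rw [div_sub_div _ _ hw h₁, div_sub_div _ _ hw h₂, div_sub_div _ _ hw h₃,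
      div_sub_div _ _ hw h₄, div_mul_div_comm, div_mul_div_comm, div_mul_div_comm,
      show w * z₁ * (w * z₂) * (w * z₃) * (w * z₄) = w ^ 4 * (z₁ * z₂ * z₃ * z₄) by ring,
      hprod]
    ring
  unfold SatisfiesHeun at heq ⊢
  beta_reduce
  rw [deriv_deriv_comp_one_div hw hF hF', hG, hP, hww,
    neg_div_sq_div_one_div_sub_one_div q₁ hw h₁ hw₁,
    neg_div_sq_div_one_div_sub_one_div q₂ hw h₂ hw₂,
    neg_div_sq_div_one_div_sub_one_div q₃ hw h₃ hw₃,
    neg_div_sq_div_one_div_sub_one_div q₄ hw h₄ hw₄,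
    one_div_one_div_sub_one_div hw h₁ hw₁, one_div_one_div_sub_one_div hw h₂ hw₂,
    one_div_one_div_sub_one_div hw h₃ hw₃, one_div_one_div_sub_one_div hw h₄ hw₄, one_div_div]
  linear_combination w ^ 4 * heq

/-- Proposition 4: inversion invariance of the symmetric Heun equation in the
circular case. -/
theorem heun_inversion_circular (φ : ℂ) (hφ : Complex.sin (2 * φ) ≠ 0)
    (z₁ z₂ z₃ z₄ : ℂ)
    (hz₁ : z₁ = Complex.exp (Complex.I * φ))
    (hz₂ : z₂ = -Complex.exp (-(Complex.I * φ)))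
    (hz₃ : z₃ = -Complex.exp (Complex.I * φ))
    (hz₄ : z₄ = Complex.exp (-(Complex.I * φ)))
    (q₁ q₂ q₃ q₄ lam w : ℂ)
    (hw : w ≠ 0 ∧ w ≠ z₁ ∧ w ≠ z₂ ∧ w ≠ z₃ ∧ w ≠ z₄)
    (F : ℂ → ℂ)
    (hF : ∀ᶠ z in nhds w, DifferentiableAt ℂ F z)
    (hF' : DifferentiableAt ℂ (deriv F) w)
    (heq : SatisfiesHeun z₁ z₂ z₃ z₄ q₁ q₂ q₃ q₄ lam F w) :
    SatisfiesHeun (1 / z₁) (1 / z₂) (1 / z₃) (1 / z₄)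
      (-q₁ / z₁ ^ 2) (-q₂ / z₂ ^ 2) (-q₃ / z₃ ^ 2) (-q₄ / z₄ ^ 2)
      (lam - (q₁ / z₁ + q₂ / z₂ + q₃ / z₃ + q₄ / z₄))
      (fun z => F (1 / z)) (1 / w) := by
  obtain ⟨hw₀, hw₁, hw₂, hw₃, hw₄⟩ := hw
  have hprod : z₁ * z₂ * z₃ * z₄ = 1 := by
    have h : Complex.exp (Complex.I * φ) * Complex.exp (-(Complex.I * φ)) = 1 := by
      rw [← Complex.exp_add, add_neg_cancel, Complex.exp_zero]
    rw [hz₁, hz₂, hz₃, hz₄]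
    linear_combination
      (Complex.exp (Complex.I * φ) * Complex.exp (-(Complex.I * φ)) + 1) * h
  exact heq.comp_one_div hprod hw₀ hw₁ hw₂ hw₃ hw₄ hF hF'
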